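/- (Tarski–Seidenberg) If S ⊆ ℝ^{n+m} is a semialgebraic set, then its image under the coordinate projection ℝ^{n+m} → ℝⁿ (forgetting the last m coordinates) is a semialgebraic subset of ℝⁿ. -/

import Mathlib

/-- A basic semialgebraic subset of `ℝⁿ`. -/
def IsBasicSemialgebraic (n : ℕ) (S : Set (Fin n → ℝ)) : Prop :=
  ∃ (r s : ℕ) (f : Fin r → MvPolynomial (Fin n) ℝ) (g : Fin s → MvPolynomial (Fin n) ℝ),
    S = {x | (∀ i, MvPolynomial.eval x (f i) = 0) ∧ ∀ j, 0 < MvPolynomial.eval x (g j)}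

/-- A semialgebraic subset of `ℝⁿ`: a finite union of basic semialgebraic sets. -/
def IsSemialgebraic (n : ℕ) (S : Set (Fin n → ℝ)) : Prop :=
  ∃ (k : ℕ) (B : Fin k → Set (Fin n → ℝ)),
    (∀ i, IsBasicSemialgebraic n (B i)) ∧ S = ⋃ i, B i

open Polynomial SignType Filter

theorem exists_orderIso_apply_eq_of_mem_Ioo {c d u b : ℝ} (hu : u ∈ Set.Ioo c d)
    (hb : b ∈ Set.Ioo c d) :
    ∃ β : ℝ ≃o ℝ, β u = b ∧ ∀ x ∉ Set.Ioo c d, β x = x := by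
  obtain ⟨hcu, hud⟩ := hu
  obtain ⟨hcb, hbd⟩ := hb
  have h1 : 0 < u - c := by linarith
  have h2 : 0 < d - u := by linarith
  have h3 : 0 < b - c := by linarith
  have h4 : 0 < d - b := by linarith
  let F : ℝ → ℝ → ℝ → ℝ := fun u b x =>
    if x ≤ c then x else if x ≤ u then c + (x - c) * ((b - c) / (u - c))
    else if x ≤ d then d - (d - x) * ((d - b) / (d - u)) else x
  have hF : ∀ x, F u b (F b u x) = x := by
    intro x
    have key1 : ∀ x, c + (c + (x - c) * ((u - c) / (b - c)) - c) * ((b - c) / (u - c)) = x := by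
      intro x; field_simp; ring
    have key2 : ∀ x, d - (d - (d - (d - x) * ((d - u) / (d - b)))) * ((d - b) / (d - u)) = x := by
      intro x; field_simp; ring
    by_cases hxc : x ≤ c
    · simp [F, hxc]
    by_cases hxb : x ≤ b
    · have e : F b u x = c + (x - c) * ((u - c) / (b - c)) := by simp [F, hxc, hxb]
      have i1 : 0 < (x - c) * ((u - c) / (b - c)) :=
        mul_pos (by linarith) (div_pos h1 h3)
      have i2 : (x - c) * ((u - c) / (b - c)) ≤ u - c := by
        rw [← mul_div_assoc, div_le_iff₀ h3]; nlinarith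
      rw [e]
      simp only [F]
      rw [if_neg (by linarith), if_pos (by linarith), key1]
    by_cases hxd : x ≤ d
    · have e : F b u x = d - (d - x) * ((d - u) / (d - b)) := by simp [F, hxc, hxb, hxd]
      have i1 : 0 ≤ (d - x) * ((d - u) / (d - b)) :=
        mul_nonneg (by linarith) (div_pos h2 h4).le
      have i2 : (d - x) * ((d - u) / (d - b)) < d - u := by
        rw [← mul_div_assoc, div_lt_iff₀ h4]; nlinarith
      rw [e]
      simp only [F]
      rw [if_neg (by linarith), if_neg (by linarith), if_pos (by linarith), key2]
    · have : ¬ x ≤ u := by linarith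
      simp [F, hxc, hxb, hxd, this]
  have hmono : StrictMono (F u b) := by
    intro x y hxy
    have k1 : 0 < (b - c) / (u - c) := div_pos h3 h1
    have k2 : 0 < (d - b) / (d - u) := div_pos h4 h2
    have e1 : (u - c) * ((b - c) / (u - c)) = b - c := by field_simp
    have e2 : (d - u) * ((d - b) / (d - u)) = d - b := by field_simp
    simp only [F]
    split_ifs <;> nlinarith
  refine ⟨hmono.orderIsoOfSurjective _ fun x => ⟨_, hF x⟩, ?_, ?_⟩
  · have : ¬ u ≤ c := by linarith
    change F u b u = b
    simp only [F]
    rw [if_neg this, if_pos le_rfl]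
    field_simp; ring
  · intro x hx
    change F u b x = x
    simp only [F]
    rw [Set.mem_Ioo, not_and_or, not_lt, not_lt] at hx
    by_cases h : x ≤ c
    · rw [if_pos h]
    · have hx' := hx.resolve_left h
      rw [if_neg h, if_neg (by linarith)]
      split_ifs with h5
      · have : x = d := by linarith
        subst this; ring
      · rfl

theorem Finset.exists_mem_Ioo_disjoint {Z : Finset ℝ} {a m M : ℝ} (hm : m ∈ Z) (hM : M ∈ Z)
    (ha : a ∈ Set.Ioo m M) (haZ : a ∉ Z) :
    ∃ z ∈ Z, ∃ z' ∈ Z, a ∈ Set.Ioo z z' ∧ ∀ w ∈ Set.Ioo z z', w ∉ Z := by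
  obtain ⟨z, hz, hzmax⟩ := (Z.filter (· < a)).exists_max_image id ⟨m, by simp [hm, ha.1]⟩
  obtain ⟨z', hz', hzmin⟩ := (Z.filter (a < ·)).exists_min_image id ⟨M, by simp [hM, ha.2]⟩
  simp only [Finset.mem_filter, id] at hz hz' hzmax hzmin
  refine ⟨z, hz.1, z', hz'.1, ⟨hz.2, hz'.2⟩, fun w hw hwZ => ?_⟩
  rcases lt_trichotomy w a with h | h | h
  · exact (hzmax w ⟨hwZ, h⟩).not_gt hw.1
  · exact haZ (h ▸ hwZ)
  · exact (hzmin w ⟨hwZ, h⟩).not_gt hw.2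

theorem exists_zero_of_sign_eq {f g : ℝ → ℝ} {z z' a : ℝ} (ha : a ∈ Set.Ioo z z')
    (hg : Continuous g) (hz : sign (f z) = sign (g z)) (hz' : sign (f z') = sign (g z'))
    (hmono : StrictMonoOn f (Set.Icc z z') ∨ StrictAntiOn f (Set.Icc z z')) (hfa : f a = 0) :
    ∃ b ∈ Set.Ioo z z', g b = 0 := by
  have hlt : z < z' := ha.1.trans ha.2
  have mz : z ∈ Set.Icc z z' := ⟨le_rfl, hlt.le⟩
  have mz' : z' ∈ Set.Icc z z' := ⟨hlt.le, le_rfl⟩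
  have ma : a ∈ Set.Icc z z' := ⟨ha.1.le, ha.2.le⟩
  rcases hmono with h | h
  · have h1 := h mz ma ha.1
    have h2 := h ma mz' ha.2
    rw [hfa] at h1 h2
    rw [sign_neg h1, eq_comm, sign_eq_neg_one_iff] at hz
    rw [sign_pos h2, eq_comm, sign_eq_one_iff] at hz'
    exact intermediate_value_Ioo hlt.le hg.continuousOn ⟨hz, hz'⟩
  · have h1 := h mz ma ha.1
    have h2 := h ma mz' ha.2
    rw [hfa] at h1 h2
    rw [sign_pos h1, eq_comm, sign_eq_one_iff] at hz
    rw [sign_neg h2, eq_comm, sign_eq_neg_one_iff] at hz'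
    exact intermediate_value_Ioo' hlt.le hg.continuousOn ⟨hz', hz⟩

theorem mem_Ioo_orderIso_iff {θ : ℝ ≃o ℝ} {z z' : ℝ} (hz : θ z = z) (hz' : θ z' = z') (a : ℝ) :
    θ a ∈ Set.Ioo z z' ↔ a ∈ Set.Ioo z z' := by
  have h1 := θ.lt_iff_lt (x := z) (y := a)
  have h2 := θ.lt_iff_lt (x := a) (y := z')
  rw [hz] at h1
  rw [hz'] at h2
  rw [Set.mem_Ioo, Set.mem_Ioo, h1, h2]

theorem exists_orderIso_map_zeros {f g : ℝ → ℝ} (hg : Continuous g) {Z : Finset ℝ} {m M : ℝ}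
    (hm : m ∈ Z) (hM : M ∈ Z) (hout : ∀ t ∉ Set.Ioo m M, f t ≠ 0)
    (hZ : ∀ z ∈ Z, sign (f z) = sign (g z))
    (hmono : ∀ z ∈ Z, ∀ z' ∈ Z, z < z' → (∀ w ∈ Set.Ioo z z', w ∉ Z) →
      StrictMonoOn f (Set.Icc z z') ∨ StrictAntiOn f (Set.Icc z z'))
    (A : Finset ℝ) (hA : ∀ a ∈ A, f a = 0) :
    ∃ θ : ℝ ≃o ℝ, (∀ z ∈ Z, θ z = z) ∧ ∀ a ∈ A, g (θ a) = 0 := by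
  classical
  induction A using Finset.induction_on with
  | empty => exact ⟨OrderIso.refl ℝ, by simp, by simp⟩
  | insert a A _ ih =>
    obtain ⟨θ, hθZ, hθA⟩ := ih fun a' h => hA a' (Finset.mem_insert_of_mem h)
    have hfa := hA a (Finset.mem_insert_self _ _)
    by_cases haZ : a ∈ Z
    · refine ⟨θ, hθZ, Finset.forall_mem_insert _ _ _ |>.2 ⟨?_, hθA⟩⟩
      have := hZ a haZ
      rw [hfa, sign_zero, eq_comm, sign_eq_zero_iff] at this
      rw [hθZ a haZ, this]
    have ha : a ∈ Set.Ioo m M := by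
      by_contra h; exact hout a h hfa
    obtain ⟨z, hz, z', hz', haz, hdis⟩ := Finset.exists_mem_Ioo_disjoint hm hM ha haZ
    have hmo := hmono z hz z' hz' (haz.1.trans haz.2) hdis
    obtain ⟨b, hb, hgb⟩ := exists_zero_of_sign_eq haz hg (hZ z hz) (hZ z' hz') hmo hfa
    obtain ⟨β, hβ, hβfix⟩ := exists_orderIso_apply_eq_of_mem_Ioo
      ((mem_Ioo_orderIso_iff (hθZ z hz) (hθZ z' hz') a).2 haz) hb
    refine ⟨θ.trans β, fun w hw => ?_, Finset.forall_mem_insert _ _ _ |>.2 ⟨?_, fun a' ha' => ?_⟩⟩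
    · rw [OrderIso.trans_apply, hθZ w hw, hβfix w fun h => hdis w h hw]
    · rw [OrderIso.trans_apply, hβ, hgb]
    · by_cases haa : a' ∈ Set.Ioo z z'
      · have hinj : Set.InjOn f (Set.Icc z z') := hmo.elim (·.injOn) (·.injOn)
        have : a' = a := hinj (Set.Ioo_subset_Icc_self haa) (Set.Ioo_subset_Icc_self haz)
          (by rw [hfa, hA a' (Finset.mem_insert_of_mem ha')])
        rw [this, OrderIso.trans_apply, hβ, hgb]
      · rw [OrderIso.trans_apply, hβfix _ fun h =>
          haa ((mem_Ioo_orderIso_iff (hθZ z hz) (hθZ z' hz') a').1 h), hθA a' ha']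

theorem sign_eq_of_strictMonoOn {f g : ℝ → ℝ} {z z' t : ℝ} (ht : t ∈ Set.Ioo z z')
    (hf : ContinuousOn f (Set.Icc z z'))
    (hz : sign (f z) = sign (g z)) (hz' : sign (f z') = sign (g z'))
    (hfm : StrictMonoOn f (Set.Icc z z')) (hgm : StrictMonoOn g (Set.Icc z z'))
    (hzero : ∀ a ∈ Set.Icc z z', f a = 0 → g a = 0) : sign (f t) = sign (g t) := by
  have hlt : z < z' := ht.1.trans ht.2
  have mz : z ∈ Set.Icc z z' := ⟨le_rfl, hlt.le⟩
  have mz' : z' ∈ Set.Icc z z' := ⟨hlt.le, le_rfl⟩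
  have mt : t ∈ Set.Icc z z' := ⟨ht.1.le, ht.2.le⟩
  by_cases h : ∃ a ∈ Set.Icc z z', f a = 0
  · obtain ⟨a, ha, hfa⟩ := h
    have hga := hzero a ha hfa
    rcases lt_trichotomy t a with h | h | h
    · have h1 := hfm mt ha h
      have h2 := hgm mt ha h
      rw [hfa] at h1
      rw [hga] at h2
      rw [sign_neg h1, sign_neg h2]
    · rw [h, hfa, hga]
    · have h1 := hfm ha mt h
      have h2 := hgm ha mt h
      rw [hfa] at h1
      rw [hga] at h2
      rw [sign_pos h1, sign_pos h2]
  · push Not at h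
    rcases (h z mz).lt_or_gt with h0 | h0
    · have h1 : f z' < 0 := by
        refine (h z' mz').lt_or_gt.resolve_right fun h1 => ?_
        obtain ⟨a, ha, hfa⟩ := intermediate_value_Icc hlt.le hf ⟨h0.le, h1.le⟩
        exact h a ha hfa
      rw [sign_neg h1, eq_comm, sign_eq_neg_one_iff] at hz'
      rw [sign_neg ((hfm mt mz' ht.2).trans h1), sign_neg ((hgm mt mz' ht.2).trans hz')]
    · rw [sign_pos h0, eq_comm, sign_eq_one_iff] at hz
      rw [sign_pos (h0.trans (hfm mz mt ht.1)), sign_pos (hz.trans (hgm mz mt ht.1))]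

theorem sign_eq_of_strictAntiOn {f g : ℝ → ℝ} {z z' t : ℝ} (ht : t ∈ Set.Ioo z z')
    (hf : ContinuousOn f (Set.Icc z z'))
    (hz : sign (f z) = sign (g z)) (hz' : sign (f z') = sign (g z'))
    (hfm : StrictAntiOn f (Set.Icc z z')) (hgm : StrictAntiOn g (Set.Icc z z'))
    (hzero : ∀ a ∈ Set.Icc z z', f a = 0 → g a = 0) : sign (f t) = sign (g t) := by
  have := sign_eq_of_strictMonoOn (f := -f) (g := -g) ht hf.neg
    (by simp [Left.sign_neg, hz]) (by simp [Left.sign_neg, hz']) hfm.neg hgm.neg (by simpa using hzero)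
  simpa [Left.sign_neg] using this

/-- If `f` and `g` have the same signs on a finite set `Z` and off a bounded interval, and are
piecewise monotone in the same direction between points of `Z`, then they have the same sign pattern
up to a reparametrization of the line which fixes `Z`. -/
theorem exists_orderIso_sign_eq_of_piecewise_monotone {f g : ℝ → ℝ} (hf : Continuous f)
    (hg : Continuous g) (hfin : {t | f t = 0}.Finite) {Z : Finset ℝ} {m M : ℝ} {s₁ s₂ : SignType}
    (hm : m ∈ Z) (hM : M ∈ Z) (hs₁ : s₁ ≠ 0) (hs₂ : s₂ ≠ 0)
    (hleft : ∀ t ≤ m, sign (f t) = s₁ ∧ sign (g t) = s₁)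
    (hright : ∀ t, M ≤ t → sign (f t) = s₂ ∧ sign (g t) = s₂)
    (hZ : ∀ z ∈ Z, sign (f z) = sign (g z))
    (hmono : ∀ z ∈ Z, ∀ z' ∈ Z, z < z' → (∀ w ∈ Set.Ioo z z', w ∉ Z) →
      (StrictMonoOn f (Set.Icc z z') ∧ StrictMonoOn g (Set.Icc z z')) ∨
      (StrictAntiOn f (Set.Icc z z') ∧ StrictAntiOn g (Set.Icc z z'))) :
    ∃ θ : ℝ ≃o ℝ, (∀ z ∈ Z, θ z = z) ∧ ∀ t, sign (f t) = sign (g (θ t)) := by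
  obtain ⟨θ, hθZ, hθ⟩ := exists_orderIso_map_zeros (f := f) hg hm hM
    (fun t ht h0 => by
      rw [Set.mem_Ioo, not_and_or, not_lt, not_lt] at ht
      rcases ht with ht | ht
      · exact hs₁ (by rw [← (hleft t ht).1, h0, sign_zero])
      · exact hs₂ (by rw [← (hright t ht).1, h0, sign_zero]))
    hZ (fun z hz z' hz' h h' => (hmono z hz z' hz' h h').imp And.left And.left)
    hfin.toFinset (by simp)
  refine ⟨θ, hθZ, fun t => ?_⟩
  by_cases htZ : t ∈ Z
  · rw [hθZ t htZ, hZ t htZ]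
  by_cases htm : t ≤ m
  · have : θ t ≤ m := hθZ m hm ▸ θ.monotone htm
    rw [(hleft t htm).1, (hleft _ this).2]
  by_cases htM : M ≤ t
  · have : M ≤ θ t := hθZ M hM ▸ θ.monotone htM
    rw [(hright t htM).1, (hright _ this).2]
  obtain ⟨z, hz, z', hz', ht, hdis⟩ :=
    Finset.exists_mem_Ioo_disjoint hm hM ⟨not_le.1 htm, not_le.1 htM⟩ htZ
  have hmaps : Set.MapsTo θ (Set.Icc z z') (Set.Icc z z') := fun w hw =>
    ⟨hθZ z hz ▸ θ.monotone hw.1, hθZ z' hz' ▸ θ.monotone hw.2⟩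
  have hzero : ∀ a ∈ Set.Icc z z', f a = 0 → (g ∘ θ) a = 0 := fun a _ ha => hθ a (by simpa using ha)
  have e : sign (f z) = sign ((g ∘ θ) z) := by rw [Function.comp, hθZ z hz, hZ z hz]
  have e' : sign (f z') = sign ((g ∘ θ) z') := by rw [Function.comp, hθZ z' hz', hZ z' hz']
  rcases hmono z hz z' hz' (ht.1.trans ht.2) hdis with ⟨h1, h2⟩ | ⟨h1, h2⟩
  · exact sign_eq_of_strictMonoOn ht hf.continuousOn e e' h1
      (h2.comp (θ.strictMono.strictMonoOn _) hmaps) hzero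
  · exact sign_eq_of_strictAntiOn ht hf.continuousOn e e' h1
      (h2.comp_strictMonoOn (θ.strictMono.strictMonoOn _) hmaps) hzero

theorem sign_eq_of_forall_ne_zero {f : ℝ → ℝ} {s : Set ℝ} (hs : s.OrdConnected)
    (hf : ContinuousOn f s) (h : ∀ w ∈ s, f w ≠ 0) {t t' : ℝ} (ht : t ∈ s) (ht' : t' ∈ s) :
    sign (f t) = sign (f t') := by
  have hc := (hs.isPreconnected.image f hf).ordConnected
  have h0 : (0 : ℝ) ∉ f '' s := fun ⟨w, hw, hw'⟩ => h w hw hw'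
  rcases (h t ht).lt_or_gt with h1 | h1 <;> rcases (h t' ht').lt_or_gt with h2 | h2
  · rw [sign_neg h1, sign_neg h2]
  · exact (h0 (hc.out ⟨t, ht, rfl⟩ ⟨t', ht', rfl⟩ ⟨h1.le, h2.le⟩)).elim
  · exact (h0 (hc.out ⟨t', ht', rfl⟩ ⟨t, ht, rfl⟩ ⟨h2.le, h1.le⟩)).elim
  · rw [sign_pos h1, sign_pos h2]

theorem sign_comp_orderIso_eq {f : ℝ → ℝ} (hf : Continuous f) {θ : ℝ ≃o ℝ}
    (h : ∀ z, f z = 0 → θ z = z) (t : ℝ) : sign (f (θ t)) = sign (f t) := by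
  by_cases ht : f t = 0
  · rw [h t ht]
  refine sign_eq_of_forall_ne_zero (s := Set.uIcc t (θ t)) Set.ordConnected_uIcc hf.continuousOn
    (fun w hw hw0 => ht ?_) Set.right_mem_uIcc Set.left_mem_uIcc
  have hθw := h w hw0
  suffices t = w by rwa [this]
  rcases Set.mem_uIcc.1 hw with ⟨h1, h2⟩ | ⟨h1, h2⟩
  · exact le_antisymm h1 (θ.le_iff_le.1 (by rwa [hθw]))
  · exact le_antisymm (θ.le_iff_le.1 (by rwa [hθw])) h2

theorem Polynomial.eventually_sign_eval_atTop {p : ℝ[X]} (hp : 0 < p.natDegree) :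
    ∀ᶠ t in atTop, sign (p.eval t) = sign p.leadingCoeff := by
  have hdeg : 0 < p.degree := natDegree_pos_iff_degree_pos.1 hp
  have hlead : p.leadingCoeff ≠ 0 := leadingCoeff_ne_zero.2 (ne_zero_of_natDegree_gt hp)
  rcases hlead.lt_or_gt with h | h
  · filter_upwards [(tendsto_atBot_of_leadingCoeff_nonpos p hdeg h.le).eventually_lt_atBot 0]
      with t ht
    rw [sign_neg ht, sign_neg h]
  · filter_upwards [(tendsto_atTop_of_leadingCoeff_nonneg p hdeg h.le).eventually_gt_atTop 0]
      with t ht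
    rw [sign_pos ht, sign_pos h]

theorem Polynomial.eventually_sign_eval_atBot {p : ℝ[X]} (hp : 0 < p.natDegree) :
    ∀ᶠ t in atBot, sign (p.eval t) = (-1) ^ p.natDegree * sign p.leadingCoeff := by
  have h := eventually_sign_eval_atTop (p := p.comp (-X)) (by simpa [natDegree_comp] using hp)
  filter_upwards [tendsto_neg_atBot_atTop.eventually h] with t ht
  rw [leadingCoeff_comp (by simp)] at ht
  simpa [sign_mul, sign_pow, Left.sign_neg, mul_comm] using ht

/-- Monotonicity of a polynomial and of a reparametrized polynomial on an interval on which the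
derivatives have matching signs and do not vanish. -/
theorem Polynomial.strictMonoOn_or_strictAntiOn {p q : ℝ[X]} {φ : ℝ ≃o ℝ} {z z' : ℝ}
    (hd : ∀ t, sign (p.derivative.eval t) = sign (q.derivative.eval (φ t)))
    (h0 : ∀ w ∈ Set.Ioo z z', p.derivative.eval w ≠ 0) :
    (StrictMonoOn (fun t => p.eval t) (Set.Icc z z') ∧
      StrictMonoOn (fun t => q.eval (φ t)) (Set.Icc z z')) ∨
    (StrictAntiOn (fun t => p.eval t) (Set.Icc z z') ∧
      StrictAntiOn (fun t => q.eval (φ t)) (Set.Icc z z')) := by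
  rcases lt_or_ge z z' with hlt | hge
  swap
  · have : (Set.Icc z z').Subsingleton := Set.subsingleton_Icc_of_ge hge
    exact .inl ⟨this.strictMonoOn _, this.strictMonoOn _⟩
  obtain ⟨w, hw⟩ := exists_between hlt
  have hs : ∀ v ∈ Set.Ioo z z', sign (p.derivative.eval v) = sign (p.derivative.eval w) :=
    fun v hv => sign_eq_of_forall_ne_zero (f := fun t => p.derivative.eval t) Set.ordConnected_Ioo
      (by fun_prop) h0 hv hw
  have hs' : ∀ v ∈ Set.Ioo (φ z) (φ z'),
      sign (q.derivative.eval v) = sign (p.derivative.eval w) := by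
    intro v hv
    rw [← hs (φ.symm v) ⟨φ.lt_symm_apply.2 hv.1, φ.symm_apply_lt.2 hv.2⟩, hd, φ.apply_symm_apply]
  have hmaps : Set.MapsTo φ (Set.Icc z z') (Set.Icc (φ z) (φ z')) := fun v hv =>
    ⟨φ.monotone hv.1, φ.monotone hv.2⟩
  rcases (h0 w hw).lt_or_gt with h | h
  · refine .inr ⟨strictAntiOn_of_deriv_neg (convex_Icc _ _) (by fun_prop) fun v hv => ?_,
      (strictAntiOn_of_deriv_neg (f := fun t => q.eval t) (convex_Icc (φ z) (φ z')) (by fun_prop)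
        fun v hv => ?_).comp_strictMonoOn (φ.strictMono.strictMonoOn _) hmaps⟩
    · rw [interior_Icc] at hv
      rw [Polynomial.deriv, ← sign_eq_neg_one_iff, hs v hv, sign_neg h]
    · rw [interior_Icc] at hv
      rw [Polynomial.deriv, ← sign_eq_neg_one_iff, hs' v hv, sign_neg h]
  · refine .inl ⟨strictMonoOn_of_deriv_pos (convex_Icc _ _) (by fun_prop) fun v hv => ?_,
      (strictMonoOn_of_deriv_pos (f := fun t => q.eval t) (convex_Icc (φ z) (φ z')) (by fun_prop)
        fun v hv => ?_).comp (φ.strictMono.strictMonoOn _) hmaps⟩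
    · rw [interior_Icc] at hv
      rw [Polynomial.deriv, ← sign_eq_one_iff, hs v hv, sign_pos h]
    · rw [interior_Icc] at hv
      rw [Polynomial.deriv, ← sign_eq_one_iff, hs' v hv, sign_pos h]

/-- A matching of the sign patterns of finitely many polynomials, including the derivative of `p`,
which matches the signs of `p` at their zeros, can be corrected to match `p` as well. -/
theorem Polynomial.exists_orderIso_sign_eq_of_derivative {ι : Type*} [Finite ι] {P Q : ι → ℝ[X]}
    {p q : ℝ[X]} {φ : ℝ ≃o ℝ} (hp : 0 < p.natDegree) (hpq : p.natDegree = q.natDegree)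
    (hlead : sign p.leadingCoeff = sign q.leadingCoeff)
    (hPQ : ∀ i t, sign ((P i).eval t) = sign ((Q i).eval (φ t)))
    (hd : ∀ t, sign (p.derivative.eval t) = sign (q.derivative.eval (φ t)))
    (hP0 : ∀ i, P i ≠ 0 → ∀ t, (P i).eval t = 0 → sign (p.eval t) = sign (q.eval (φ t)))
    (hd0 : ∀ t, p.derivative.eval t = 0 → sign (p.eval t) = sign (q.eval (φ t))) :
    ∃ ψ : ℝ ≃o ℝ, (∀ i t, sign ((P i).eval t) = sign ((Q i).eval (ψ t))) ∧
      ∀ t, sign (p.eval t) = sign (q.eval (ψ t)) := by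
  classical
  cases nonempty_fintype ι
  have hp0 : p ≠ 0 := ne_zero_of_natDegree_gt hp
  have hp'0 : p.derivative ≠ 0 := fun h => hp.ne' (derivative_eq_zero.1 h)
  have hc : sign p.leadingCoeff ≠ 0 := by simpa [sign_eq_zero_iff] using hp0
  obtain ⟨m, hm⟩ := eventually_atBot.1 ((eventually_sign_eval_atBot hp).and
    (φ.tendsto_atBot.eventually (eventually_sign_eval_atBot (hpq ▸ hp))))
  obtain ⟨M, hM⟩ := eventually_atTop.1 ((eventually_sign_eval_atTop hp).and
    (φ.tendsto_atTop.eventually (eventually_sign_eval_atTop (hpq ▸ hp))))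
  rw [← hpq, ← hlead] at hm
  rw [← hlead] at hM
  let Z : Finset ℝ := {m, M} ∪ p.derivative.roots.toFinset ∪
    Finset.univ.biUnion fun i => (P i).roots.toFinset
  have hZ : ∀ z ∈ Z, sign (p.eval z) = sign (q.eval (φ z)) := by
    intro z hz
    simp only [Z, Finset.mem_union, Finset.mem_insert, Finset.mem_singleton, Multiset.mem_toFinset,
      Finset.mem_biUnion, Finset.mem_univ, true_and, mem_roots', IsRoot.def] at hz
    rcases hz with ((rfl | rfl) | h) | ⟨i, hi, h⟩
    · rw [(hm _ le_rfl).1, (hm _ le_rfl).2]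
    · rw [(hM _ le_rfl).1, (hM _ le_rfl).2]
    · exact hd0 z h.2
    · exact hP0 i hi z h
  obtain ⟨θ, hθZ, hθ⟩ := exists_orderIso_sign_eq_of_piecewise_monotone
    (f := fun t => p.eval t) (g := fun t => q.eval (φ t)) (by fun_prop)
    (q.continuous.comp φ.continuous)
    ((p.roots.toFinset.finite_toSet).subset fun t ht => by simpa [hp0] using ht)
    (Z := Z) (by simp [Z]) (by simp [Z])
    (mul_ne_zero (pow_ne_zero _ (by decide)) hc) hc hm hM hZ
    fun z _ z' _ _ hdis => strictMonoOn_or_strictAntiOn hd fun w hw hw0 =>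
      hdis w hw (by simp [Z, hp'0, hw0])
  refine ⟨θ.trans φ, fun i t => ?_, hθ⟩
  rw [OrderIso.trans_apply, ← hPQ]
  by_cases hi : P i = 0
  · simp [hi]
  · refine (sign_comp_orderIso_eq (f := fun t => (P i).eval t) (by fun_prop)
      (fun z hz => hθZ z ?_) t).symm
    simp only [Z, Finset.mem_union, Finset.mem_biUnion]
    exact .inr ⟨i, Finset.mem_univ i, by simpa [hi] using hz⟩

theorem Polynomial.exists_pseudo_division {R : Type*} [CommRing R] {f : R[X]} {k : ℕ}
    (hf : f.natDegree ≤ k) (p : R[X]) :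
    ∃ (n : ℕ) (q r : R[X]), C (f.coeff k) ^ n * p = q * f + r ∧ r.degree < k := by
  by_cases hk : p.degree < k
  · exact ⟨0, 0, p, by simp, hk⟩
  induction h : p.natDegree using Nat.strong_induction_on generalizing p with
  | _ e ih =>
  have hke : k ≤ e := by
    rw [not_lt] at hk
    have := hk.trans degree_le_natDegree
    rw [h] at this
    exact_mod_cast this
  let p₁ := C (f.coeff k) * p - C (p.coeff e) * X ^ (e - k) * f
  have hdeg : p₁.natDegree ≤ e := by
    refine (natDegree_sub_le _ _).trans (max_le ?_ ?_)
    · exact (natDegree_C_mul_le _ _).trans h.le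
    · refine natDegree_mul_le.trans ?_
      have := natDegree_C_mul_X_pow_le (p.coeff e) (e - k)
      omega
  have hcoeff : p₁.coeff e = 0 := by
    have : (C (p.coeff e) * X ^ (e - k) * f).coeff e = p.coeff e * f.coeff k := by
      rw [mul_assoc, coeff_C_mul, coeff_X_pow_mul', if_pos (by omega)]
      congr 2; omega
    rw [coeff_sub, coeff_C_mul, this]; ring
  have key : ∃ (n : ℕ) (q r : R[X]), C (f.coeff k) ^ n * p₁ = q * f + r ∧ r.degree < k := by
    by_cases hk₁ : p₁.degree < k
    · exact ⟨0, 0, p₁, by simp, hk₁⟩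
    · refine ih p₁.natDegree (hdeg.lt_of_ne fun he => hk₁ ?_) p₁ hk₁ rfl
      have : p₁ = 0 := leadingCoeff_eq_zero.1 (by rw [leadingCoeff, he, hcoeff])
      rw [this, degree_zero]
      exact WithBot.bot_lt_coe _
  obtain ⟨n, q, r, hqr, hr⟩ := key
  refine ⟨n + 1, C (f.coeff k) ^ n * (C (p.coeff e) * X ^ (e - k)) + q, r, ?_, hr⟩
  linear_combination hqr

theorem Polynomial.eval₂_erase {R : Type*} [CommRing R] {x : R →+* ℝ} {p : R[X]} {k : ℕ}
    (h : x (p.coeff k) = 0) (t : ℝ) : (p.erase k).eval₂ x t = p.eval₂ x t := by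
  conv_rhs => rw [← monomial_add_erase p k]
  simp [eval₂_monomial, h]

theorem Polynomial.map_erase_of_map_coeff_eq_zero {R : Type*} [CommRing R] {x : R →+* ℝ}
    {p : R[X]} {k : ℕ} (h : x (p.coeff k) = 0) : (p.erase k).map x = p.map x := by
  conv_rhs => rw [← monomial_add_erase p k]
  simp [h]

theorem Polynomial.natDegree_erase_succ_le {R : Type*} [CommRing R] {p : R[X]} {k : ℕ}
    (h : p.natDegree ≤ k + 1) : (p.erase (k + 1)).natDegree ≤ k := by
  refine natDegree_le_iff_coeff_eq_zero.2 fun i hi => ?_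
  rw [coeff_erase]
  split_ifs with hik
  · rfl
  · exact coeff_eq_zero_of_natDegree_lt (by omega)

/-- The values of `p` at the zeros of `f` are, up to positive factors, values of polynomials of
degree less than that of `f`, whichever coefficients of `f` vanish after specialization. -/
theorem Polynomial.exists_remainders {R : Type*} [CommRing R] (p f : R[X]) {d : ℕ}
    (hf : f.natDegree ≤ d + 1) :
    ∃ (S : Finset R[X]) (G : Finset R), (∀ r ∈ S, r.natDegree ≤ d) ∧
      ∀ x y : R →+* ℝ, (∀ g ∈ G, sign (x g) = sign (y g)) → f.map x ≠ 0 →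
        ∃ r ∈ S, ∃ a > 0, ∃ b > 0, ∀ t,
          (f.eval₂ x t = 0 → a * p.eval₂ x t = r.eval₂ x t) ∧
          (f.eval₂ y t = 0 → b * p.eval₂ y t = r.eval₂ y t) := by
  classical
  obtain ⟨k, hk, hkd⟩ : ∃ k, f.natDegree ≤ k ∧ k ≤ d + 1 := ⟨_, le_rfl, hf⟩
  clear hf
  induction k generalizing f with
  | zero =>
    obtain ⟨c, rfl⟩ := natDegree_eq_zero.1 (Nat.le_zero.1 hk)
    refine ⟨{0}, {c}, by simp, fun x y hxy hfx => ⟨0, by simp, 1, one_pos, 1, one_pos, fun t => ?_⟩⟩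
    have hx : x c ≠ 0 := by simpa using hfx
    have hy : y c ≠ 0 := by
      rwa [← sign_ne_zero, ← hxy c (by simp), sign_ne_zero]
    simp [hx, hy]
  | succ k ih =>
    obtain ⟨S, G, hS, hSG⟩ := ih (f.erase (k + 1)) (natDegree_erase_succ_le hk) (by omega)
    obtain ⟨n, q, r, hqr, hr⟩ := exists_pseudo_division hk p
    refine ⟨insert (C (f.coeff (k + 1)) ^ n * r) S, insert (f.coeff (k + 1)) G,
      Finset.forall_mem_insert _ _ _ |>.2 ⟨?_, hS⟩, fun x y hxy hfx => ?_⟩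
    · rw [← C_pow]
      refine (natDegree_C_mul_le _ _).trans ?_
      have : r.natDegree < k + 1 := by
        by_cases h0 : r = 0
        · simp [h0]
        · exact (natDegree_lt_iff_degree_lt h0).2 hr
      omega
    · rw [Finset.forall_mem_insert] at hxy
      by_cases hc : x (f.coeff (k + 1)) = 0
      · have hc' : y (f.coeff (k + 1)) = 0 := by
          rw [← sign_eq_zero_iff, ← hxy.1, hc, sign_zero]
        obtain ⟨r, hr, h⟩ := hSG x y hxy.2 (by rwa [map_erase_of_map_coeff_eq_zero hc])
        simp only [eval₂_erase hc, eval₂_erase hc'] at h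
        exact ⟨r, Finset.mem_insert_of_mem hr, h⟩
      · have hc' : y (f.coeff (k + 1)) ≠ 0 := by
          rwa [← sign_ne_zero, ← hxy.1, sign_ne_zero]
        have key : ∀ (z : R →+* ℝ) (t : ℝ), f.eval₂ z t = 0 →
            (z (f.coeff (k + 1)) ^ n) ^ 2 * p.eval₂ z t =
              (C (f.coeff (k + 1)) ^ n * r).eval₂ z t := by
          intro z t ht
          have := congrArg (eval₂ z t) hqr
          simp only [eval₂_mul, eval₂_add, eval₂_pow, eval₂_C, ht] at this ⊢
          linear_combination z (f.coeff (k + 1)) ^ n * this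
        exact ⟨_, Finset.mem_insert_self _ _, _, by positivity, _, by positivity,
          fun t => ⟨key x t, key y t⟩⟩

theorem Polynomial.exists_reduction {R : Type*} [CommRing R] (p : R[X]) (K : Finset R[X]) {d : ℕ}
    (hp : p.natDegree ≤ d + 1) (hK : ∀ f ∈ K, f.natDegree ≤ d + 1) :
    ∃ (S : Finset R[X]) (G : Finset R), (∀ r ∈ S, r.natDegree ≤ d) ∧
      ∀ x y : R →+* ℝ, (∀ g ∈ G, sign (x g) = sign (y g)) → x (p.coeff (d + 1)) ≠ 0 →
        ∀ φ : ℝ ≃o ℝ,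
          (∀ f, f ∈ K ∨ f ∈ S → ∀ t, sign (f.eval₂ x t) = sign (f.eval₂ y (φ t))) →
          ∃ ψ : ℝ ≃o ℝ, ∀ f, f = p ∨ f ∈ K →
            ∀ t, sign (f.eval₂ x t) = sign (f.eval₂ y (ψ t)) := by
  classical
  have hp' : p.derivative.natDegree ≤ d := (natDegree_derivative_le p).trans (by omega)
  have hrem : ∀ f : R[X], ∃ (S : Finset R[X]) (G : Finset R), f.natDegree ≤ d + 1 →
      (∀ r ∈ S, r.natDegree ≤ d) ∧
      ∀ x y : R →+* ℝ, (∀ g ∈ G, sign (x g) = sign (y g)) → f.map x ≠ 0 →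
        ∃ r ∈ S, ∃ a > 0, ∃ b > 0, ∀ t,
          (f.eval₂ x t = 0 → a * p.eval₂ x t = r.eval₂ x t) ∧
          (f.eval₂ y t = 0 → b * p.eval₂ y t = r.eval₂ y t) := by
    intro f
    by_cases hf : f.natDegree ≤ d + 1
    · obtain ⟨S, G, h⟩ := exists_remainders p f hf
      exact ⟨S, G, fun _ => h⟩
    · exact ⟨∅, ∅, fun h => (hf h).elim⟩
  choose S G hSG using hrem
  have hK' : ∀ f ∈ insert p.derivative K, f.natDegree ≤ d + 1 :=
    (Finset.forall_mem_insert _ _ _).2 ⟨by omega, hK⟩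
  refine ⟨insert p.derivative ((insert p.derivative K).biUnion S),
    insert (p.coeff (d + 1)) ((insert p.derivative K).biUnion G), ?_, ?_⟩
  · refine (Finset.forall_mem_insert _ _ _).2 ⟨hp', fun r hr => ?_⟩
    obtain ⟨f, hf, hr⟩ := Finset.mem_biUnion.1 hr
    exact (hSG f (hK' f hf)).1 r hr
  intro x y hxy hcx φ hφ
  rw [Finset.forall_mem_insert] at hxy
  obtain ⟨hc, hG⟩ := hxy
  have hcy : y (p.coeff (d + 1)) ≠ 0 := by rwa [← sign_ne_zero, ← hc, sign_ne_zero]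
  have hdeg : ∀ z : R →+* ℝ, z (p.coeff (d + 1)) ≠ 0 → (p.map z).natDegree = d + 1 := fun z hz =>
    natDegree_eq_of_le_of_coeff_ne_zero (natDegree_map_le.trans hp) (by rwa [coeff_map])
  have hsign : ∀ f ∈ insert p.derivative K, ∀ t,
      sign (f.eval₂ x t) = sign (f.eval₂ y (φ t)) := fun f hf => by
    rcases Finset.mem_insert.1 hf with rfl | hf
    · exact hφ _ (by simp)
    · exact hφ f (by simp [hf])
  have hzero : ∀ f ∈ insert p.derivative K, f.map x ≠ 0 → ∀ t, f.eval₂ x t = 0 →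
      sign (p.eval₂ x t) = sign (p.eval₂ y (φ t)) := by
    intro f hf hfx t ht
    obtain ⟨r, hr, a, ha, b, hb, hab⟩ := (hSG f (hK' f hf)).2 x y
      (fun g hg => hG g (Finset.mem_biUnion.2 ⟨f, hf, hg⟩)) hfx
    have ht' : f.eval₂ y (φ t) = 0 := by
      rw [← sign_eq_zero_iff, ← hsign f hf, ht, sign_zero]
    have h := hφ r (.inr (Finset.mem_insert_of_mem (Finset.mem_biUnion.2 ⟨f, hf, hr⟩))) t
    rw [← (hab t).1 ht, ← (hab (φ t)).2 ht', sign_mul, sign_mul, sign_pos ha, sign_pos hb] at h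
    simpa using h
  have hp'x : p.derivative.map x ≠ 0 := fun h => by
    rw [← derivative_map, derivative_eq_zero, hdeg x hcx] at h
    omega
  obtain ⟨ψ, hψ, hψp⟩ := exists_orderIso_sign_eq_of_derivative (ι := K)
    (P := fun f => (f : R[X]).map x) (Q := fun f => (f : R[X]).map y) (p := p.map x) (q := p.map y)
    (φ := φ) (by rw [hdeg x hcx]; omega) (by rw [hdeg x hcx, hdeg y hcy])
    (by rw [leadingCoeff, leadingCoeff, hdeg x hcx, hdeg y hcy, coeff_map, coeff_map, hc])
    (fun f t => by
      rw [eval_map, eval_map]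
      exact hsign f (Finset.mem_insert_of_mem f.2) t)
    (fun t => by
      rw [derivative_map, derivative_map, eval_map, eval_map]
      exact hsign _ (Finset.mem_insert_self _ _) t)
    (fun f hf t ht => by
      rw [eval_map] at ht
      rw [eval_map, eval_map]
      exact hzero f (Finset.mem_insert_of_mem f.2) hf t ht)
    (fun t ht => by
      rw [derivative_map, eval_map] at ht
      rw [eval_map, eval_map]
      exact hzero _ (Finset.mem_insert_self _ _) hp'x t ht)
  refine ⟨ψ, ?_⟩
  rintro f (rfl | hf) t
  · simpa only [eval_map] using hψp t
  · simpa only [eval_map] using hψ ⟨f, hf⟩ t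

/-- The sign pattern on the line of a finite family of polynomials, up to reparametrization, is
determined by the signs of finitely many elements of the coefficient ring. -/
theorem Polynomial.exists_finset_orderIso_sign_eq {R : Type*} [CommRing R] (F : Finset R[X]) :
    ∃ G : Finset R, ∀ x y : R →+* ℝ, (∀ g ∈ G, sign (x g) = sign (y g)) →
      ∃ φ : ℝ ≃o ℝ, ∀ f ∈ F, ∀ t, sign (f.eval₂ x t) = sign (f.eval₂ y (φ t)) := by
  classical
  suffices H : ∀ (d : ℕ) (F : Finset R[X]), (∀ f ∈ F, f.natDegree ≤ d) →
      ∃ G : Finset R, ∀ x y : R →+* ℝ, (∀ g ∈ G, sign (x g) = sign (y g)) →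
        ∃ φ : ℝ ≃o ℝ, ∀ f ∈ F, ∀ t, sign (f.eval₂ x t) = sign (f.eval₂ y (φ t)) from
    H (F.sup natDegree) F fun f hf => Finset.le_sup hf
  intro d
  induction d with
  | zero =>
    intro F hF
    refine ⟨F.image (coeff · 0), fun x y hxy => ⟨OrderIso.refl ℝ, fun f hf t => ?_⟩⟩
    have := hxy _ (Finset.mem_image_of_mem _ hf)
    rw [eq_C_of_natDegree_le_zero (hF f hf), eval₂_C, eval₂_C, this]
  | succ d ihd =>
    intro F hF
    suffices H : ∀ L : Finset R[X], (∀ f ∈ L, f.natDegree ≤ d) →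
        ∃ G : Finset R, ∀ x y : R →+* ℝ, (∀ g ∈ G, sign (x g) = sign (y g)) →
          ∃ φ : ℝ ≃o ℝ, ∀ f ∈ F ∪ L, ∀ t, sign (f.eval₂ x t) = sign (f.eval₂ y (φ t)) by
      simpa using H ∅ (by simp)
    induction F using Finset.induction_on with
    | empty => intro L hL; simpa using ihd L hL
    | insert p F _ ihF =>
      intro L hL
      rw [Finset.forall_mem_insert] at hF
      have hFL : ∀ f ∈ F ∪ L, f.natDegree ≤ d + 1 := fun f hf =>
        (Finset.mem_union.1 hf).elim (hF.2 f) fun h => (hL f h).trans d.le_succ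
      obtain ⟨S, G₀, hS, hSG⟩ := exists_reduction p (F ∪ L) hF.1 hFL
      obtain ⟨G₁, hG₁⟩ := ihF hF.2 (insert (p.erase (d + 1)) L)
        ((Finset.forall_mem_insert _ _ _).2 ⟨natDegree_erase_succ_le hF.1, hL⟩)
      obtain ⟨G₂, hG₂⟩ := ihF hF.2 (L ∪ S) fun f hf =>
        (Finset.mem_union.1 hf).elim (hL f) (hS f)
      refine ⟨insert (p.coeff (d + 1)) (G₀ ∪ G₁ ∪ G₂), fun x y hxy => ?_⟩
      by_cases hc : x (p.coeff (d + 1)) = 0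
      · have hc' : y (p.coeff (d + 1)) = 0 := by
          rw [← sign_eq_zero_iff, ← hxy _ (Finset.mem_insert_self _ _), hc, sign_zero]
        obtain ⟨φ, hφ⟩ := hG₁ x y fun g hg => hxy g (by simp [hg])
        refine ⟨φ, fun f hf t => ?_⟩
        rw [Finset.insert_union] at hf
        rcases Finset.mem_insert.1 hf with rfl | hf
        · rw [← eval₂_erase hc, ← eval₂_erase hc']
          exact hφ _ (by simp) t
        · refine hφ f ?_ t
          rw [Finset.union_insert]
          exact Finset.mem_insert_of_mem hf
      · obtain ⟨φ, hφ⟩ := hG₂ x y fun g hg => hxy g (by simp [hg])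
        obtain ⟨ψ, hψ⟩ := hSG x y (fun g hg => hxy g (by simp [hg])) hc φ fun f hf =>
          hφ f (by simpa [or_assoc] using hf)
        exact ⟨ψ, fun f hf => hψ f (by simpa [or_assoc] using hf)⟩

theorem isBasicSemialgebraic_setOf {n : ℕ} {ι κ : Type*} [Finite ι] [Finite κ]
    (f : ι → MvPolynomial (Fin n) ℝ) (g : κ → MvPolynomial (Fin n) ℝ) :
    IsBasicSemialgebraic n
      {x | (∀ i, MvPolynomial.eval x (f i) = 0) ∧ ∀ j, 0 < MvPolynomial.eval x (g j)} := by
  let e := (Finite.equivFin ι).symm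
  let e' := (Finite.equivFin κ).symm
  refine ⟨_, _, f ∘ e, g ∘ e', ?_⟩
  ext x
  simp [e.forall_congr_left, e'.forall_congr_left]

theorem isBasicSemialgebraic_setOf_sign_eq {n : ℕ} (G : Finset (MvPolynomial (Fin n) ℝ))
    (σ : G → SignType) :
    IsBasicSemialgebraic n {x | ∀ g : G, sign (MvPolynomial.eval x g.1) = σ g} := by
  convert isBasicSemialgebraic_setOf (fun g : G => if σ g = 0 then g.1 else 0)
    (fun g : G => if σ g = 0 then 1 else if σ g = 1 then g.1 else -g.1) using 1
  ext x
  simp only [Set.mem_ofPred_eq, ← forall_and]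
  refine forall_congr' fun g => ?_
  cases σ g <;> simp [sign_eq_zero_iff, sign_eq_one_iff, sign_eq_neg_one_iff]

/-- A set is semialgebraic iff membership depends only on the signs of finitely many polynomials. -/
theorem isSemialgebraic_iff_exists_finset {n : ℕ} {S : Set (Fin n → ℝ)} :
    IsSemialgebraic n S ↔ ∃ G : Finset (MvPolynomial (Fin n) ℝ), ∀ x y : Fin n → ℝ,
      (∀ g ∈ G, sign (MvPolynomial.eval x g) = sign (MvPolynomial.eval y g)) → x ∈ S → y ∈ S := by
  classical
  constructor
  · rintro ⟨k, B, hB, rfl⟩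
    choose r s f g hfg using hB
    refine ⟨Finset.univ.biUnion fun i => Finset.univ.image (f i) ∪ Finset.univ.image (g i),
      fun x y hxy hx => ?_⟩
    obtain ⟨i, hi⟩ := Set.mem_iUnion.1 hx
    refine Set.mem_iUnion.2 ⟨i, ?_⟩
    rw [hfg] at hi ⊢
    refine ⟨fun j => ?_, fun j => ?_⟩
    · rw [← sign_eq_zero_iff, ← hxy (f i j) (Finset.mem_biUnion.2 ⟨i, by simp⟩), hi.1 j, sign_zero]
    · rw [← sign_eq_one_iff, ← hxy (g i j) (Finset.mem_biUnion.2 ⟨i, by simp⟩), sign_pos (hi.2 j)]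
  · rintro ⟨G, hG⟩
    let T := {σ : G → SignType // ∃ x ∈ S, ∀ g : G, sign (MvPolynomial.eval x g.1) = σ g}
    let e := (Finite.equivFin T).symm
    refine ⟨_, fun i => {x | ∀ g : G, sign (MvPolynomial.eval x g.1) = (e i).1 g},
      fun i => isBasicSemialgebraic_setOf_sign_eq G _, ?_⟩
    ext y
    rw [Set.mem_iUnion]
    constructor
    · intro hy
      exact ⟨e.symm ⟨fun g => sign (MvPolynomial.eval y g.1), y, hy, fun _ => rfl⟩, by simp⟩
    · rintro ⟨i, hi⟩
      obtain ⟨x, hx, hxi⟩ := (e i).2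
      exact hG x y (fun g hg => (hxi ⟨g, hg⟩).trans (hi ⟨g, hg⟩).symm) hx

theorem IsSemialgebraic.image_castSucc {n : ℕ} {S : Set (Fin (n + 1) → ℝ)}
    (hS : IsSemialgebraic (n + 1) S) :
    IsSemialgebraic n ((fun x i => x (Fin.castSucc i)) '' S) := by
  classical
  rw [isSemialgebraic_iff_exists_finset] at hS ⊢
  obtain ⟨F, hF⟩ := hS
  let Φ : MvPolynomial (Fin (n + 1)) ℝ →+* (MvPolynomial (Fin n) ℝ)[X] :=
    MvPolynomial.eval₂Hom (C.comp MvPolynomial.C)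
      (Fin.snoc (α := fun _ => (MvPolynomial (Fin n) ℝ)[X]) (fun i => C (MvPolynomial.X i)) X)
  have hΦ : ∀ (x : Fin n → ℝ) (t : ℝ) (f : MvPolynomial (Fin (n + 1)) ℝ),
      (Φ f).eval₂ (MvPolynomial.eval x) t =
        MvPolynomial.eval (Fin.snoc (α := fun _ => ℝ) x t) f := by
    intro x t f
    suffices (eval₂RingHom (MvPolynomial.eval x) t).comp Φ =
        MvPolynomial.eval (Fin.snoc (α := fun _ => ℝ) x t) from congrArg (· f) this
    refine MvPolynomial.ringHom_ext (fun c => by simp [Φ]) fun i => ?_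
    refine Fin.lastCases ?_ (fun i => ?_) i <;> simp [Φ]
  obtain ⟨G, hG⟩ := exists_finset_orderIso_sign_eq (F.image Φ)
  refine ⟨G, ?_⟩
  rintro _ y hxy ⟨z, hz, rfl⟩
  obtain ⟨φ, hφ⟩ := hG _ _ hxy
  refine ⟨Fin.snoc (α := fun _ => ℝ) y (φ (z (Fin.last n))), hF z _ (fun f hf => ?_) hz, by simp⟩
  have h := hφ (Φ f) (Finset.mem_image_of_mem _ hf) (z (Fin.last n))
  rw [hΦ, hΦ] at h
  rwa [show Fin.snoc (α := fun _ => ℝ) (fun i => z (Fin.castSucc i)) (z (Fin.last n)) = z from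
    Fin.snoc_init_self z] at h

/-- Tarski–Seidenberg: the image of a semialgebraic subset of `ℝ^{n+m}` under the
projection to the first `n` coordinates is a semialgebraic subset of `ℝⁿ`. -/
theorem tarski_seidenberg (n m : ℕ) (S : Set (Fin (n + m) → ℝ))
    (hS : IsSemialgebraic (n + m) S) :
    IsSemialgebraic n ((fun x : Fin (n + m) → ℝ => fun i : Fin n => x (Fin.castAdd m i)) '' S) := by
  induction m with
  | zero => simpa using hS
  | succ m ih =>
    have := ih _ hS.image_castSucc
    rw [Set.image_image] at this
    exact this
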